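/- Let n be a positive natural number, let f : ℝ^n → ℝ be a function, let x be a vector in ℝ^n, and suppose f is differentiable at x with gradient g_f ≠ 0. Let g_L be any vector in ℝ^n and let δ > 0 be a real number. Define v* = ((−⟪g_L, g_f⟫ + δ)/‖g_f‖²) • g_f. Then there exists γ₀ > 0 such that for every real γ with 0 < γ < γ₀, one has f(x − γ • (v* + g_L)) < f(x). -/

import Mathlib

open RealInnerProductSpace

/-- A sufficiently small step against any direction that has positive inner product with the
gradient strictly decreases the function. -/
theorem HasGradientAt.exists_forall_sub_smul_lt {E : Type*} [NormedAddCommGroup E]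
    [InnerProductSpace ℝ E] [CompleteSpace E] {f : E → ℝ} {g x v : E}
    (hf : HasGradientAt f g x) (hv : 0 < ⟪g, v⟫) :
    ∃ γ₀ : ℝ, 0 < γ₀ ∧ ∀ γ : ℝ, 0 < γ → γ < γ₀ → f (x - γ • v) < f x := by
  have hd : HasDerivAt (fun t : ℝ => f (x + t • -v)) (-⟪g, v⟫) 0 := by
    simpa [HasLineDerivAt] using hf.hasFDerivAt.hasLineDerivAt (-v)
  have hev := (hasDerivAt_iff_tendsto_slope.1 hd).eventually_lt_const (neg_lt_zero.2 hv)
  rw [eventually_nhdsWithin_iff, Metric.eventually_nhds_iff] at hev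
  obtain ⟨ε, hε, h⟩ := hev
  refine ⟨ε, hε, fun γ hγ hγε => ?_⟩
  have hs := h (by simpa [abs_of_pos hγ] using hγε) hγ.ne'
  rw [slope_def_field, div_neg_iff] at hs
  rcases hs with ⟨-, hs⟩ | ⟨hs, -⟩
  · linarith
  · simpa [sub_eq_add_neg] using hs

/-- The pulled direction has inner product `δ` with `g`. -/
theorem inner_pull_add {E : Type*} [NormedAddCommGroup E] [InnerProductSpace ℝ E] {g : E}
    (hg : g ≠ 0) (w : E) (δ : ℝ) :
    ⟪g, ((-⟪w, g⟫ + δ) / ‖g‖ ^ 2) • g + w⟫ = δ := by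
  have hn : ‖g‖ ≠ 0 := norm_ne_zero_iff.2 hg
  rw [inner_add_right, real_inner_smul_right, real_inner_self_eq_norm_sq, real_inner_comm w g,
    div_mul_cancel₀ _ (pow_ne_zero 2 hn)]
  ring

theorem stmt_11 (n : ℕ) (hn : 0 < n) (f : EuclideanSpace ℝ (Fin n) → ℝ)
    (x gf gL : EuclideanSpace ℝ (Fin n))
    (hf : HasGradientAt f gf x) (hgf : gf ≠ 0)
    (δ : ℝ) (hδ : 0 < δ) (vstar : EuclideanSpace ℝ (Fin n))
    (hv : vstar = ((-⟪gL, gf⟫ + δ) / ‖gf‖ ^ 2) • gf) :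
    ∃ γ₀ : ℝ, 0 < γ₀ ∧ ∀ γ : ℝ, 0 < γ → γ < γ₀ → f (x - γ • (vstar + gL)) < f x := by
  refine hf.exists_forall_sub_smul_lt ?_
  rwa [hv, inner_pull_add hgf]
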